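/- Let a > 0, μ ∈ ℝ, α > 0, and a₁₂, a₂₂ ∈ ℝ with a₂₂ − a₁₂² ≥ α. For η ∈ ℝ set κ(η) = (i·a₁₂·η + √(a₂₂(a+μ²) + (a₂₂−a₁₂²)η²))/a₂₂, and let ψ : ℝ → ℂ be a Schwartz function with Fourier transform ψ̂(η) = ∫_ℝ e^(−iηt)ψ(t)dt. Define u(x₁,x₂) = (2π)^(−1)·∫_ℝ exp(i·η·x₁ − κ(η)·x₂)·ψ̂(η) dη for (x₁,x₂) ∈ ℝ × [0,∞). Then the integral converges absolutely, u is twice continuously differentiable on ℝ × [0,∞), u(x₁,0) = ψ(x₁) for all x₁, and u satisfies −∂₁₁u − 2a₁₂·∂₁₂u − a₂₂·∂₂₂u + (a + μ²)·u = 0 at every point of ℝ × (0,∞). -/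

import Mathlib

open Complex MeasureTheory

/-- First partial derivative of a function of two real variables. -/
noncomputable def pd1 {E : Type*} [NormedAddCommGroup E] [NormedSpace ℝ E]
    (u : ℝ × ℝ → E) (p : ℝ × ℝ) : E :=
  deriv (fun t => u (t, p.2)) p.1

/-- Second partial derivative of a function of two real variables. -/
noncomputable def pd2 {E : Type*} [NormedAddCommGroup E] [NormedSpace ℝ E]
    (u : ℝ × ℝ → E) (p : ℝ × ℝ) : E :=
  deriv (fun t => u (p.1, t)) p.2

open Filter Topology Set in
/-- Differentiation under the integral sign within a convex set. -/
theorem aux_hasFDerivWithinAt_integral {s : Set (ℝ × ℝ)} (hs : Convex ℝ s)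
    {F : ℝ → ℝ × ℝ → ℂ} {F' : ℝ → ℝ × ℝ → (ℝ × ℝ →L[ℝ] ℂ)} {b : ℝ → ℝ}
    (hF : ∀ p ∈ s, Integrable (fun η => F η p))
    (hF' : ∀ p ∈ s, Integrable (fun η => F' η p))
    (hd : ∀ η, ∀ p ∈ s, HasFDerivWithinAt (F η) (F' η p) s p)
    (hb : ∀ η, ∀ p ∈ s, ‖F' η p‖ ≤ b η) (hbi : Integrable b)
    (p : ℝ × ℝ) (hp : p ∈ s) :
    HasFDerivWithinAt (fun q => ∫ η, F η q) (∫ η, F' η p) s p := by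
  rw [hasFDerivWithinAt_iff_tendsto]
  have key : Tendsto (fun q => ∫ η, ‖q - p‖⁻¹ * ‖F η q - F η p - F' η p (q - p)‖)
      (𝓝[s] p) (𝓝 (∫ _η : ℝ, (0 : ℝ))) := by
    refine tendsto_integral_filter_of_dominated_convergence (fun η => 2 * b η) ?_ ?_ ?_ ?_
    · filter_upwards [self_mem_nhdsWithin] with q hq
      exact ((((hF q hq).sub (hF p hp)).sub
        ((hF' p hp).apply_continuousLinearMap (q - p))).norm.const_mul _).aestronglyMeasurable
    · filter_upwards [self_mem_nhdsWithin] with q hq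
      refine Eventually.of_forall fun η => ?_
      have h1 : ‖F η q - F η p‖ ≤ b η * ‖q - p‖ :=
        hs.norm_image_sub_le_of_norm_hasFDerivWithin_le (hd η) (hb η) hp hq
      have h2 : ‖F' η p (q - p)‖ ≤ b η * ‖q - p‖ :=
        (F' η p).le_of_opNorm_le (hb η p hp) _
      have h3 : ‖F η q - F η p - F' η p (q - p)‖ ≤ 2 * b η * ‖q - p‖ :=
        (norm_sub_le _ _).trans (by linarith)
      have hb0 : 0 ≤ b η := (norm_nonneg _).trans (hb η p hp)
      rw [norm_mul, norm_norm, norm_inv, norm_norm]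
      rcases (norm_nonneg (q - p)).eq_or_lt with h0 | h0
      · rw [← h0]; simp; positivity
      · rw [inv_mul_le_iff₀ h0]; linarith
    · exact hbi.const_mul 2
    · exact Eventually.of_forall fun η => hasFDerivWithinAt_iff_tendsto.1 (hd η p hp)
  simp only [integral_zero] at key
  refine squeeze_zero' (Eventually.of_forall fun q => by positivity) ?_ key
  filter_upwards [self_mem_nhdsWithin] with q hq
  have e : (∫ η, F η q) - (∫ η, F η p) - (∫ η, F' η p) (q - p)
      = ∫ η, (F η q - F η p - F' η p (q - p)) := by
    rw [ContinuousLinearMap.integral_apply (hF' p hp), integral_sub, integral_sub (hF q hq) (hF p hp)]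
    · exact (hF q hq).sub (hF p hp)
    · exact (hF' p hp).apply_continuousLinearMap _
  rw [e, integral_const_mul]
  gcongr
  exact norm_integral_le_integral_norm _

/-- Rapidly decreasing continuous functions. -/
def AuxGood (g : ℝ → ℂ) : Prop :=
  Continuous g ∧ ∀ n : ℕ, Integrable (fun η : ℝ => |η| ^ n * ‖g η‖)

theorem AuxGood.mul {g m : ℝ → ℂ} (hg : AuxGood g) (hm : Continuous m) {C : ℝ}
    (hC : ∀ η, ‖m η‖ ≤ C * (1 + |η|)) : AuxGood (fun η => m η * g η) := by
  refine ⟨hm.mul hg.1, fun n => ?_⟩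
  refine Integrable.mono' (((hg.2 n).add (hg.2 (n+1))).const_mul C) ?_ ?_
  · have := hg.1
    exact Continuous.aestronglyMeasurable (by fun_prop)
  · refine Filter.Eventually.of_forall fun η => ?_
    simp only [Pi.add_apply, norm_mul, norm_pow, norm_norm]
    rw [Real.norm_eq_abs, abs_abs]
    calc |η| ^ n * (‖m η‖ * ‖g η‖) ≤ |η| ^ n * ((C * (1 + |η|)) * ‖g η‖) := by
          gcongr; exact hC η
      _ = C * (|η| ^ n * ‖g η‖ + |η| ^ (n + 1) * ‖g η‖) := by ring

/-- The exponential kernel. -/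
noncomputable def auxE (κ : ℝ → ℂ) (η : ℝ) (p : ℝ × ℝ) : ℂ :=
  Complex.exp (Complex.I * (η : ℂ) * (p.1 : ℂ) - κ η * (p.2 : ℂ))

noncomputable def auxU (κ g : ℝ → ℂ) (p : ℝ × ℝ) : ℂ := ∫ η : ℝ, auxE κ η p * g η

noncomputable def auxL1 : ℝ × ℝ →L[ℝ] ℂ := Complex.ofRealCLM.comp (ContinuousLinearMap.fst ℝ ℝ ℝ)
noncomputable def auxL2 : ℝ × ℝ →L[ℝ] ℂ := Complex.ofRealCLM.comp (ContinuousLinearMap.snd ℝ ℝ ℝ)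

theorem auxE_norm_le {κ : ℝ → ℂ} (hre : ∀ η, 0 ≤ (κ η).re) (η : ℝ) {p : ℝ × ℝ} (hp : 0 ≤ p.2) :
    ‖auxE κ η p‖ ≤ 1 := by
  rw [auxE, Complex.norm_exp, Real.exp_le_one_iff]
  have := mul_nonneg (hre η) hp
  simp; linarith

theorem aux_integrable {κ g : ℝ → ℂ} (hc : Continuous κ) (hre : ∀ η, 0 ≤ (κ η).re)
    (hg : AuxGood g) {p : ℝ × ℝ} (hp : 0 ≤ p.2) : Integrable (fun η => auxE κ η p * g η) := by
  have h0 := hg.2 0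
  refine Integrable.mono' h0 ?_ ?_
  · have := hg.1
    unfold auxE
    exact Continuous.aestronglyMeasurable (by fun_prop)
  · refine Filter.Eventually.of_forall fun η => ?_
    rw [norm_mul]
    simpa using mul_le_mul_of_nonneg_right (auxE_norm_le hre η hp) (norm_nonneg (g η))

theorem auxL1_norm : ‖auxL1‖ ≤ 1 := by
  refine ContinuousLinearMap.opNorm_le_bound _ zero_le_one fun x => ?_
  simpa [auxL1] using norm_fst_le x

theorem auxL2_norm : ‖auxL2‖ ≤ 1 := by
  refine ContinuousLinearMap.opNorm_le_bound _ zero_le_one fun x => ?_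
  simpa [auxL2] using norm_snd_le x

theorem auxE_hasFDerivAt (κ : ℝ → ℂ) (η : ℝ) (c : ℂ) (p : ℝ × ℝ) :
    HasFDerivAt (fun q => auxE κ η q * c)
      ((auxE κ η p * ((Complex.I * η) * c)) • auxL1 + (auxE κ η p * ((-κ η) * c)) • auxL2) p := by
  have h1 : HasFDerivAt (fun q : ℝ × ℝ => (q.1 : ℂ)) auxL1 p := auxL1.hasFDerivAt
  have h2 : HasFDerivAt (fun q : ℝ × ℝ => (q.2 : ℂ)) auxL2 p := auxL2.hasFDerivAt
  have h := (((h1.const_mul (Complex.I * (η : ℂ))).sub (h2.const_mul (κ η))).cexp).mul_const c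
  refine h.congr_fderiv ?_
  ext <;> simp [auxE, auxL1, auxL2] <;> ring

section
variable {κ g : ℝ → ℂ} {C : ℝ}

theorem AuxGood.d1 (hg : AuxGood g) : AuxGood (fun η => (Complex.I * η) * g η) :=
  hg.mul (C := 1) (by fun_prop) (fun η => by simp)

theorem AuxGood.d2 (hg : AuxGood g) (hc : Continuous κ) (hC : ∀ η, ‖κ η‖ ≤ C * (1 + |η|)) :
    AuxGood (fun η => (-κ η) * g η) :=
  hg.mul (C := C) (by fun_prop) (fun η => by simpa using hC η)

theorem auxU_hasFDerivWithinAt (hc : Continuous κ) (hre : ∀ η, 0 ≤ (κ η).re)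
    (hC : ∀ η, ‖κ η‖ ≤ C * (1 + |η|)) (hg : AuxGood g) (p : ℝ × ℝ) (hp : 0 ≤ p.2) :
    HasFDerivWithinAt (auxU κ g)
      (auxU κ (fun η => (Complex.I * η) * g η) p • auxL1 +
        auxU κ (fun η => (-κ η) * g η) p • auxL2) {p : ℝ × ℝ | 0 ≤ p.2} p := by
  have i1 := fun {p : ℝ × ℝ} (hp : 0 ≤ p.2) => aux_integrable hc hre hg.d1 hp
  have i2 := fun {p : ℝ × ℝ} (hp : 0 ≤ p.2) => aux_integrable hc hre (hg.d2 hc hC) hp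
  have hconv : Convex ℝ {p : ℝ × ℝ | 0 ≤ p.2} :=
    convex_halfSpace_ge (f := fun p : ℝ × ℝ => p.2) (LinearMap.isLinear (LinearMap.snd ℝ ℝ ℝ)) 0
  have h := aux_hasFDerivWithinAt_integral (F := fun η q => auxE κ η q * g η)
    (F' := fun η p => (auxE κ η p * ((Complex.I * η) * g η)) • auxL1
      + (auxE κ η p * ((-κ η) * g η)) • auxL2)
    (b := fun η => ‖(Complex.I * η) * g η‖ + ‖(-κ η) * g η‖) hconv
    (fun p hp => aux_integrable hc hre hg hp)
    (fun p hp => ((i1 hp).smul_const auxL1).add ((i2 hp).smul_const auxL2))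
    (fun η p _ => (auxE_hasFDerivAt κ η (g η) p).hasFDerivWithinAt)
    ?_ ?_ p hp
  · refine h.congr_fderiv ?_
    rw [integral_add ((i1 hp).smul_const auxL1) ((i2 hp).smul_const auxL2),
      integral_smul_const, integral_smul_const]
    rfl
  · intro η p hp
    refine (norm_add_le _ _).trans (add_le_add ?_ ?_)
    · rw [norm_smul, norm_mul]
      calc _ ≤ 1 * ‖(Complex.I * η) * g η‖ * 1 := by
            gcongr
            · exact auxE_norm_le hre η hp
            · exact auxL1_norm
        _ = _ := by ring
    · rw [norm_smul, norm_mul]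
      calc _ ≤ 1 * ‖(-κ η) * g η‖ * 1 := by
            gcongr
            · exact auxE_norm_le hre η hp
            · exact auxL2_norm
        _ = _ := by ring
  · have a1 := hg.d1.2 0
    have a2 := (hg.d2 hc hC).2 0
    simp only [pow_zero, one_mul] at a1 a2
    exact a1.add a2

theorem auxU_contDiffOn (hc : Continuous κ) (hre : ∀ η, 0 ≤ (κ η).re)
    (hC : ∀ η, ‖κ η‖ ≤ C * (1 + |η|)) (n : ℕ) : ∀ g : ℝ → ℂ, AuxGood g →
    ContDiffOn ℝ n (auxU κ g) {p : ℝ × ℝ | 0 ≤ p.2} := by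
  induction n with
  | zero =>
    intro g hg
    rw [Nat.cast_zero, contDiffOn_zero]
    exact fun p hp => (auxU_hasFDerivWithinAt hc hre hC hg p hp).continuousWithinAt
  | succ n ih =>
    intro g hg
    rw [Nat.cast_succ, contDiffOn_succ_iff_hasFDerivWithinAt (by simp)]
    intro x hx
    refine ⟨{p : ℝ × ℝ | 0 ≤ p.2}, ?_, by simp, _,
      fun p hp => auxU_hasFDerivWithinAt hc hre hC hg p hp, ?_⟩
    · rw [Set.insert_eq_of_mem hx]; exact self_mem_nhdsWithin
    · exact ((ih _ hg.d1).smul contDiffOn_const).add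
        ((ih _ (hg.d2 hc hC)).smul contDiffOn_const)

theorem auxU_hasFDerivAt (hc : Continuous κ) (hre : ∀ η, 0 ≤ (κ η).re)
    (hC : ∀ η, ‖κ η‖ ≤ C * (1 + |η|)) (hg : AuxGood g) (p : ℝ × ℝ) (hp : 0 < p.2) :
    HasFDerivAt (auxU κ g)
      (auxU κ (fun η => (Complex.I * η) * g η) p • auxL1 +
        auxU κ (fun η => (-κ η) * g η) p • auxL2) p := by
  refine (auxU_hasFDerivWithinAt hc hre hC hg p hp.le).hasFDerivAt ?_
  filter_upwards [(isOpen_lt continuous_const continuous_snd).mem_nhds hp] with q hq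
  exact le_of_lt hq

theorem aux_pd1 (hc : Continuous κ) (hre : ∀ η, 0 ≤ (κ η).re)
    (hC : ∀ η, ‖κ η‖ ≤ C * (1 + |η|)) (hg : AuxGood g) (p : ℝ × ℝ) (hp : 0 < p.2) :
    pd1 (auxU κ g) p = auxU κ (fun η => (Complex.I * η) * g η) p := by
  have h := (auxU_hasFDerivAt hc hre hC hg p hp).comp_hasDerivAt p.1
    ((hasDerivAt_id p.1).prodMk (hasDerivAt_const p.1 p.2))
  have h' := h.deriv
  simp [auxL1, auxL2] at h'
  exact h'

theorem aux_pd2 (hc : Continuous κ) (hre : ∀ η, 0 ≤ (κ η).re)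
    (hC : ∀ η, ‖κ η‖ ≤ C * (1 + |η|)) (hg : AuxGood g) (p : ℝ × ℝ) (hp : 0 < p.2) :
    pd2 (auxU κ g) p = auxU κ (fun η => (-κ η) * g η) p := by
  have h := (auxU_hasFDerivAt hc hre hC hg p hp).comp_hasDerivAt p.2
    ((hasDerivAt_const p.2 p.1).prodMk (hasDerivAt_id p.2))
  have h' := h.deriv
  simp [auxL1, auxL2] at h'
  simp only [neg_mul]
  exact h'

end

theorem aux_pd1_congr {v w : ℝ × ℝ → ℂ} (h : ∀ p : ℝ × ℝ, 0 < p.2 → v p = w p)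
    (p : ℝ × ℝ) (hp : 0 < p.2) : pd1 v p = pd1 w p := by
  unfold pd1
  congr 1
  funext t
  exact h _ hp

theorem aux_pd2_congr {v w : ℝ × ℝ → ℂ} (h : ∀ p : ℝ × ℝ, 0 < p.2 → v p = w p)
    (p : ℝ × ℝ) (hp : 0 < p.2) : pd2 v p = pd2 w p := by
  unfold pd2
  apply Filter.EventuallyEq.deriv_eq
  filter_upwards [lt_mem_nhds hp] with t ht
  exact h _ ht

open FourierTransform in
theorem aux_hat (ψ : SchwartzMap ℝ ℂ) (η : ℝ) :
    (∫ t : ℝ, Complex.exp (-Complex.I * (η : ℂ) * (t : ℂ)) * ψ t)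
      = (𝓕 ψ : SchwartzMap ℝ ℂ) (η / (2 * Real.pi)) := by
  rw [SchwartzMap.fourier_coe, Real.fourier_real_eq_integral_exp_smul]
  congr 1
  funext t
  rw [smul_eq_mul]
  congr 2
  have : (Real.pi : ℂ) ≠ 0 := by exact_mod_cast Real.pi_ne_zero
  push_cast
  field_simp

theorem aux_good_schwartz (f : SchwartzMap ℝ ℂ) :
    AuxGood (fun η => f (η / (2 * Real.pi))) := by
  refine ⟨f.continuous.comp (by fun_prop), fun n => ?_⟩
  have h := ((f.integrable_pow_mul volume n).comp_div
    (R := 2 * Real.pi) (by positivity)).const_mul ((2 * Real.pi) ^ n)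
  refine h.congr (Filter.Eventually.of_forall fun η => ?_)
  simp only [Real.norm_eq_abs, abs_div]
  rw [abs_of_pos (show (0:ℝ) < 2 * Real.pi by positivity), div_pow]
  have := Real.pi_pos
  field_simp

open FourierTransform in
theorem aux_inversion (ψ : SchwartzMap ℝ ℂ) (x : ℝ) :
    ((2 * Real.pi : ℝ) : ℂ)⁻¹ * ∫ η : ℝ, Complex.exp (Complex.I * (η : ℂ) * (x : ℂ)) *
      (𝓕 ψ : SchwartzMap ℝ ℂ) (η / (2 * Real.pi)) = ψ x := by
  have hpi : (Real.pi : ℂ) ≠ 0 := by exact_mod_cast Real.pi_ne_zero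
  have h1 : (𝓕⁻ (𝓕 ψ : SchwartzMap ℝ ℂ) : SchwartzMap ℝ ℂ) x = ψ x := by
    rw [FourierTransform.fourierInv_fourier_eq]
  rw [SchwartzMap.fourierInv_coe, Real.fourierInv_eq'] at h1
  rw [← h1]
  have h2 := Measure.integral_comp_div (fun ξ : ℝ => Complex.exp (((2 * Real.pi * (ξ * x) : ℝ) : ℂ) * Complex.I) *
    (𝓕 ψ : SchwartzMap ℝ ℂ) ξ) (2 * Real.pi)
  have h3 : (∫ η : ℝ, Complex.exp (Complex.I * (η : ℂ) * (x : ℂ)) *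
      (𝓕 ψ : SchwartzMap ℝ ℂ) (η / (2 * Real.pi))) = |2 * Real.pi| • ∫ y : ℝ,
        Complex.exp (((2 * Real.pi * (y * x) : ℝ) : ℂ) * Complex.I) *
          (𝓕 ψ : SchwartzMap ℝ ℂ) y := by
    refine Eq.trans ?_ h2
    congr 1
    funext η
    congr 2
    push_cast
    field_simp
  rw [h3, abs_of_pos (by positivity), Complex.real_smul, inv_mul_cancel_left₀ (by simp [Real.pi_ne_zero])]
  congr 1
  funext η
  simp [mul_comm x η]

/-- Existence and representation part of Theorem 5.1 in the scalar case:
`u = F⁻¹ (e^{−κ(η)x₂} Fψ)` converges absolutely, is `C²` on the closed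
half-plane, attains the boundary value `ψ` at `x₂ = 0`, and solves
`−∂₁₁u − 2a₁₂∂₁₂u − a₂₂∂₂₂u + (a + μ²)u = 0` on the open half-plane. -/
theorem stmt_9 (a μ α a₁₂ a₂₂ : ℝ) (ha : 0 < a) (hα : 0 < α) (hell : a₂₂ - a₁₂ ^ 2 ≥ α)
    (κ : ℝ → ℂ)
    (hκ : ∀ η : ℝ, κ η = (Complex.I * (a₁₂ : ℂ) * (η : ℂ) +
        ((Real.sqrt (a₂₂ * (a + μ ^ 2) + (a₂₂ - a₁₂ ^ 2) * η ^ 2) : ℝ) : ℂ)) / (a₂₂ : ℂ))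
    (ψ : SchwartzMap ℝ ℂ)
    (ψhat : ℝ → ℂ)
    (hψhat : ∀ η : ℝ, ψhat η = ∫ t : ℝ, Complex.exp (-Complex.I * (η : ℂ) * (t : ℂ)) * ψ t)
    (u : ℝ × ℝ → ℂ)
    (hu : ∀ p : ℝ × ℝ, u p = ((2 * Real.pi : ℝ) : ℂ)⁻¹ *
        ∫ η : ℝ, Complex.exp (Complex.I * (η : ℂ) * (p.1 : ℂ) - κ η * (p.2 : ℂ)) * ψhat η) :
    (∀ p : ℝ × ℝ, 0 ≤ p.2 →
        Integrable (fun η : ℝ =>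
          Complex.exp (Complex.I * (η : ℂ) * (p.1 : ℂ) - κ η * (p.2 : ℂ)) * ψhat η)) ∧
    ContDiffOn ℝ 2 u {p : ℝ × ℝ | 0 ≤ p.2} ∧
    (∀ x₁ : ℝ, u (x₁, 0) = ψ x₁) ∧
    (∀ p : ℝ × ℝ, 0 < p.2 →
        -pd1 (pd1 u) p - (2 * (a₁₂ : ℂ)) * pd1 (pd2 u) p - (a₂₂ : ℂ) * pd2 (pd2 u) p
          + ((a : ℂ) + (μ : ℂ) ^ 2) * u p = 0) := by
  have hA : 0 < a₂₂ := by nlinarith [sq_nonneg a₁₂]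
  have hAC : (a₂₂ : ℂ) ≠ 0 := by exact_mod_cast hA.ne'
  have hm : 0 ≤ a + μ ^ 2 := by positivity
  have hd : 0 ≤ a₂₂ - a₁₂ ^ 2 := by linarith
  have hc : Continuous κ := by
    rw [funext hκ]
    fun_prop
  have hre : ∀ η, 0 ≤ (κ η).re := by
    intro η
    rw [hκ, Complex.div_ofReal_re]
    simp only [Complex.add_re, Complex.ofReal_re]
    have : (Complex.I * (a₁₂ : ℂ) * (η : ℂ)).re = 0 := by simp
    rw [this, zero_add]
    positivity
  set S : ℝ := √(a₂₂ * (a + μ ^ 2)) with hS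
  set T : ℝ := √(a₂₂ - a₁₂ ^ 2) with hT
  have hS2 : S ^ 2 = a₂₂ * (a + μ ^ 2) := Real.sq_sqrt (by positivity)
  have hT2 : T ^ 2 = a₂₂ - a₁₂ ^ 2 := Real.sq_sqrt hd
  have hS0 : 0 ≤ S := Real.sqrt_nonneg _
  have hT0 : 0 ≤ T := Real.sqrt_nonneg _
  have hC : ∀ η, ‖κ η‖ ≤ ((|a₁₂| + S + T) / a₂₂) * (1 + |η|) := by
    intro η
    have h1 : √(a₂₂ * (a + μ ^ 2) + (a₂₂ - a₁₂ ^ 2) * η ^ 2) ≤ S + T * |η| := by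
      refine Real.sqrt_le_iff.2 ⟨by positivity, ?_⟩
      have : 0 ≤ S * (T * |η|) := by positivity
      rw [← hS2, ← hT2, ← sq_abs η]
      nlinarith
    rw [hκ, norm_div, Complex.norm_real, Real.norm_of_nonneg hA.le, div_mul_eq_mul_div]
    gcongr
    refine (norm_add_le _ _).trans ?_
    rw [Complex.norm_real, Real.norm_of_nonneg (Real.sqrt_nonneg _)]
    have h2 : ‖Complex.I * (a₁₂ : ℂ) * (η : ℂ)‖ = |a₁₂| * |η| := by simp
    rw [h2]
    have := abs_nonneg a₁₂
    have := abs_nonneg η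
    nlinarith [mul_nonneg hS0 (abs_nonneg η)]
  have hchar : ∀ η : ℝ, (a₂₂ : ℂ) * κ η ^ 2 - 2 * Complex.I * a₁₂ * η * κ η
      - (a + μ ^ 2 + η ^ 2) = 0 := by
    intro η
    have h0 : 0 ≤ a₂₂ * (a + μ ^ 2) + (a₂₂ - a₁₂ ^ 2) * η ^ 2 := by positivity
    have hsq := Real.sq_sqrt h0
    rw [hκ]
    generalize √(a₂₂ * (a + μ ^ 2) + (a₂₂ - a₁₂ ^ 2) * η ^ 2) = r at hsq
    have hsq' : (r : ℂ) ^ 2 = a₂₂ * (a + μ ^ 2) + (a₂₂ - a₁₂ ^ 2) * η ^ 2 := by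
      exact_mod_cast hsq
    field_simp
    linear_combination hsq' - (a₁₂ : ℂ) ^ 2 * η ^ 2 * Complex.I_sq
  have hψ : ψhat = fun η => (FourierTransform.fourier ψ : SchwartzMap ℝ ℂ) (η / (2 * Real.pi)) := by
    funext η
    rw [hψhat, aux_hat]
  have hgood : AuxGood ψhat := by
    rw [hψ]
    exact aux_good_schwartz _
  set g : ℝ → ℂ := fun η => ((2 * Real.pi : ℝ) : ℂ)⁻¹ * ψhat η with hgdef
  have hg : AuxGood g := by
    refine hgood.mul (C := ‖((2 * Real.pi : ℝ) : ℂ)⁻¹‖) continuous_const fun η => ?_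
    have := norm_nonneg (((2 * Real.pi : ℝ) : ℂ)⁻¹)
    nlinarith [mul_nonneg this (abs_nonneg η)]
  have huU : u = auxU κ g := by
    funext p
    rw [hu, auxU, ← integral_const_mul]
    congr 1
    funext η
    simp only [hgdef, auxE]
    ring
  refine ⟨fun p hp => aux_integrable hc hre hgood hp, ?_, ?_, ?_⟩
  · rw [huU]
    exact_mod_cast auxU_contDiffOn hc hre hC 2 g hg
  · intro x
    rw [hu, ← aux_inversion ψ x, hψ]
    simp
  · intro p hp
    have hg1 := hg.d1
    have hg2 := hg.d2 hc hC
    have e11 : pd1 (pd1 u) p = auxU κ (fun η => (Complex.I * η) * ((Complex.I * η) * g η)) p := by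
      rw [huU]
      exact (aux_pd1_congr (fun q hq => aux_pd1 hc hre hC hg q hq) p hp).trans
        (aux_pd1 hc hre hC hg1 p hp)
    have e12 : pd1 (pd2 u) p = auxU κ (fun η => (Complex.I * η) * ((-κ η) * g η)) p := by
      rw [huU]
      exact (aux_pd1_congr (fun q hq => aux_pd2 hc hre hC hg q hq) p hp).trans
        (aux_pd1 hc hre hC hg2 p hp)
    have e22 : pd2 (pd2 u) p = auxU κ (fun η => (-κ η) * ((-κ η) * g η)) p := by
      rw [huU]
      exact (aux_pd2_congr (fun q hq => aux_pd2 hc hre hC hg q hq) p hp).trans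
        (aux_pd2 hc hre hC hg2 p hp)
    rw [e11, e12, e22, huU]
    have j0 := aux_integrable hc hre hg hp.le
    have j11 := aux_integrable hc hre hg1.d1 hp.le
    have j12 := aux_integrable hc hre hg2.d1 hp.le
    have j22 := aux_integrable hc hre (hg2.d2 hc hC) hp.le
    unfold auxU
    rw [← integral_neg, ← integral_const_mul, ← integral_const_mul, ← integral_const_mul]
    have j12' := j12.const_mul (2 * (a₁₂ : ℂ))
    have j22' := j22.const_mul (a₂₂ : ℂ)
    have j0' := j0.const_mul ((a : ℂ) + (μ : ℂ) ^ 2)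
    have s1 := integral_sub j11.neg j12'
    have s2 := integral_sub (j11.neg.sub j12') j22'
    have s3 := integral_add ((j11.neg.sub j12').sub j22') j0'
    simp only [Pi.sub_apply, Pi.neg_apply] at s1 s2 s3
    rw [← s1, ← s2, ← s3]
    rw [← integral_zero ℝ ℂ (μ := volume)]
    congr 1
    funext η
    linear_combination (-(auxE κ η p * g η)) * hchar η
      - auxE κ η p * g η * (η : ℂ) ^ 2 * Complex.I_sq
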